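/- There is an absolute constant C such that for every continuously differentiable function m : ℝ/ℤ → ℂ and every k ∈ ℤ: ∑_{n∈ℤ} |m^∨(n)| ≤ C·( |m^∨(k)| + ( ‖m‖_{L²(ℝ/ℤ)} · ‖(d/dβ)(e(kβ)·m(β))‖_{L²(ℝ/ℤ)} )^{1/2} ), where m^∨(n) := ∫₀¹ m(β)·e(nβ) dβ. -/

import Mathlib

open scoped ENNReal

/-- `e(t) = exp(2πit)`. -/
noncomputable def expCirc (t : ℝ) : ℂ := Complex.exp (2 * Real.pi * Complex.I * t)

/-- The `n`-th inverse Fourier coefficient `m^∨(n) = ∫₀¹ m(β) e(nβ) dβ` of a `1`-periodic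
function `m : ℝ → ℂ` (a function on the circle `ℝ/ℤ`). -/
noncomputable def invFourierCoeff (m : ℝ → ℂ) (n : ℤ) : ℂ :=
  ∫ β in (0 : ℝ)..1, m β * expCirc ((n : ℝ) * β)

/-- The `L²(ℝ/ℤ)` norm of a `1`-periodic function, `(∫₀¹ ‖m(β)‖² dβ)^{1/2}`. -/
noncomputable def circleL2Norm (m : ℝ → ℂ) : ℝ :=
  Real.sqrt (∫ β in (0 : ℝ)..1, ‖m β‖ ^ 2)

open MeasureTheory

/-- Bounding `∑ 1 / (d² + a² (i + 1)²)` by a telescoping sum. -/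
lemma sum_one_div_sq_add_sq_le {a d : ℝ} (ha : 0 < a) (hd : 0 < d) (N : ℕ) :
    ∑ i ∈ Finset.range N, 1 / (d ^ 2 + a ^ 2 * ((i : ℝ) + 1) ^ 2) ≤
      2 / a * (1 / d - 1 / (d + a * N)) := by
  induction N with
  | zero => simp
  | succ N ih =>
    rw [Finset.sum_range_succ]
    have hx : 0 < d + a * N := by positivity
    have hy : 0 < d + a * (N + 1) := by positivity
    have hxy : 2 / a * (1 / (d + a * N) - 1 / (d + a * (N + 1))) =
        2 / ((d + a * N) * (d + a * (N + 1))) := by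
      field_simp
      ring
    have hstep : 1 / (d ^ 2 + a ^ 2 * ((N : ℝ) + 1) ^ 2) ≤
        2 / ((d + a * N) * (d + a * (N + 1))) := by
      rw [div_le_div_iff₀ (by positivity) (by positivity)]
      nlinarith [sq_nonneg (d - a * (N + 1)), mul_pos ha hy]
    push_cast
    calc _ ≤ 2 / a * (1 / d - 1 / (d + a * N)) +
          2 / a * (1 / (d + a * N) - 1 / (d + a * (N + 1))) :=
          add_le_add ih (hstep.trans_eq hxy.symm)
      _ = _ := by ring

/-- A discrete Carlson inequality. -/
lemma sum_range_le_two_mul_sqrt_mul {f : ℕ → ℝ} {a d : ℝ} (ha : 0 ≤ a) (hd : 0 ≤ d) (N : ℕ)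
    (hfa : ∑ i ∈ Finset.range N, f i ^ 2 ≤ a ^ 2)
    (hfd : ∑ i ∈ Finset.range N, (((i : ℝ) + 1) * f i) ^ 2 ≤ d ^ 2) :
    ∑ i ∈ Finset.range N, f i ≤ 2 * √(a * d) := by
  rcases ha.eq_or_lt with rfl | ha
  · refine le_of_eq_of_le (Finset.sum_eq_zero fun i hi => ?_) (by positivity)
    have h := (Finset.single_le_sum (f := fun i => f i ^ 2)
      (fun j _ => sq_nonneg (f j)) hi).trans hfa
    exact pow_eq_zero_iff two_ne_zero |>.1 (le_antisymm (by simpa using h) (sq_nonneg _))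
  rcases hd.eq_or_lt with rfl | hd
  · refine le_of_eq_of_le (Finset.sum_eq_zero fun i hi => ?_) (by positivity)
    have h := (Finset.single_le_sum (f := fun i : ℕ => (((i : ℝ) + 1) * f i) ^ 2)
      (fun j _ => sq_nonneg _) hi).trans hfd
    have h' := pow_eq_zero_iff two_ne_zero |>.1
      (le_antisymm (h.trans_eq (zero_pow two_ne_zero)) (sq_nonneg _))
    exact (mul_eq_zero.1 h').resolve_left (by positivity)
  have hw : ∑ i ∈ Finset.range N, 1 / (d ^ 2 + a ^ 2 * ((i : ℝ) + 1) ^ 2) ≤ 2 / (a * d) := by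
    refine (sum_one_div_sq_add_sq_le ha hd N).trans ?_
    calc 2 / a * (1 / d - 1 / (d + a * N)) ≤ 2 / a * (1 / d) := by
          gcongr
          exact sub_le_self _ (by positivity)
      _ = 2 / (a * d) := by field_simp
  have hg : ∑ i ∈ Finset.range N, (d ^ 2 + a ^ 2 * ((i : ℝ) + 1) ^ 2) * f i ^ 2 ≤
      2 * a ^ 2 * d ^ 2 := by
    calc _ = d ^ 2 * ∑ i ∈ Finset.range N, f i ^ 2 +
          a ^ 2 * ∑ i ∈ Finset.range N, (((i : ℝ) + 1) * f i) ^ 2 := by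
          rw [Finset.mul_sum, Finset.mul_sum, ← Finset.sum_add_distrib]
          exact Finset.sum_congr rfl fun i _ => by ring
      _ ≤ d ^ 2 * a ^ 2 + a ^ 2 * d ^ 2 := by gcongr
      _ = _ := by ring
  have hcs := Finset.sum_sq_le_sum_mul_sum_of_sq_le_mul (Finset.range N) (r := f)
    (f := fun i : ℕ => 1 / (d ^ 2 + a ^ 2 * ((i : ℝ) + 1) ^ 2))
    (g := fun i : ℕ => (d ^ 2 + a ^ 2 * ((i : ℝ) + 1) ^ 2) * f i ^ 2)
    (fun i _ => by positivity) (fun i _ => by positivity) (fun i _ => le_of_eq (by field_simp))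
  refine abs_le_of_sq_le_sq' ?_ (by positivity) |>.2
  calc _ ≤ 2 / (a * d) * (2 * a ^ 2 * d ^ 2) :=
        hcs.trans (mul_le_mul hw hg (Finset.sum_nonneg fun i _ => by positivity) (by positivity))
    _ = (2 * √(a * d)) ^ 2 := by
        rw [mul_pow, Real.sq_sqrt (by positivity)]
        field_simp

lemma tsum_ofReal_int_le {c : ℤ → ℝ} (hc : ∀ n, 0 ≤ c n) {a d : ℝ} (ha : 0 ≤ a) (hd : 0 ≤ d)
    (hca : ∀ s : Finset ℤ, ∑ n ∈ s, c n ^ 2 ≤ a ^ 2)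
    (hcd : ∀ s : Finset ℤ, ∑ n ∈ s, ((n : ℝ) * c n) ^ 2 ≤ d ^ 2) :
    ∑' n : ℤ, ENNReal.ofReal (c n) ≤ ENNReal.ofReal (c 0 + 4 * √(a * d)) := by
  have key (φ : ℕ → ℤ) (hinj : φ.Injective) (hφ : ∀ i : ℕ, (φ i : ℝ) ^ 2 = ((i : ℝ) + 1) ^ 2) :
      ∑' i : ℕ, ENNReal.ofReal (c (φ i)) ≤ ENNReal.ofReal (2 * √(a * d)) := by
    refine ENNReal.tsum_le_of_sum_range_le fun N => ?_
    rw [← ENNReal.ofReal_sum_of_nonneg fun i _ => hc _]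
    refine ENNReal.ofReal_le_ofReal (sum_range_le_two_mul_sqrt_mul ha hd N ?_ ?_)
    · simpa using hca ((Finset.range N).map ⟨φ, hinj⟩)
    · simpa [mul_pow, hφ] using hcd ((Finset.range N).map ⟨φ, hinj⟩)
  have hpos := key (fun i => (i : ℤ) + 1) (fun i j h => by simpa using h) (fun i => by simp)
  have hneg := key (fun i => -((i : ℤ) + 1)) (fun i j h => by simpa using h)
    (fun i => by push_cast; ring)
  rw [tsum_of_nat_of_neg_add_one ENNReal.summable ENNReal.summable,
    tsum_eq_zero_add' ENNReal.summable]
  have h4 : c 0 + 4 * √(a * d) = c 0 + 2 * √(a * d) + 2 * √(a * d) := by ring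
  rw [h4, ENNReal.ofReal_add (add_nonneg (hc 0) (by positivity)) (by positivity),
    ENNReal.ofReal_add (hc 0) (by positivity)]
  push_cast
  gcongr

/-- Bessel's inequality on `ℝ/ℤ`. -/
lemma sum_sq_fourierCoeffOn_le {f : ℝ → ℂ} (hf : Continuous f) (s : Finset ℤ) :
    ∑ n ∈ s, ‖fourierCoeffOn zero_lt_one f n‖ ^ 2 ≤ circleL2Norm f ^ 2 := by
  have hL : MemLp f 2 (volume.restrict (Set.Ioc 0 1)) :=
    ((memLp_two_iff_integrable_sq_norm hf.aestronglyMeasurable).2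
      (((hf.norm.pow 2).integrableOn_Icc).mono_set Set.Ioc_subset_Icc_self))
  have h := sum_le_hasSum s (fun n _ => sq_nonneg _) (hasSum_sq_fourierCoeffOn zero_lt_one hL)
  rwa [sub_zero, inv_one, one_smul, ← Real.sq_sqrt (intervalIntegral.integral_nonneg zero_le_one
    fun x _ => sq_nonneg ‖f x‖)] at h

lemma norm_expCirc (t : ℝ) : ‖expCirc t‖ = 1 := by
  have : (2 * Real.pi * Complex.I * t : ℂ) = ((2 * Real.pi * t : ℝ) : ℂ) * Complex.I := by
    push_cast; ring
  rw [expCirc, this, Complex.norm_exp_ofReal_mul_I]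

lemma contDiff_expCirc_mul (x : ℝ) : ContDiff ℝ 1 fun β : ℝ => expCirc (x * β) := by
  unfold expCirc
  have : ContDiff ℝ 1 fun β : ℝ => ((x * β : ℝ) : ℂ) :=
    Complex.ofRealCLM.contDiff.comp (contDiff_const.mul contDiff_id)
  exact (contDiff_const.mul this).cexp

lemma fourierCoeffOn_expCirc_mul (m : ℝ → ℂ) (k n : ℤ) :
    fourierCoeffOn zero_lt_one (fun β => expCirc ((k : ℝ) * β) * m β) n =
      invFourierCoeff m (k - n) := by
  rw [fourierCoeffOn_eq_integral, invFourierCoeff]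
  simp only [sub_zero, div_one, one_smul]
  refine intervalIntegral.integral_congr fun x _ => ?_
  simp only [fourier_coe_apply, expCirc, smul_eq_mul]
  rw [← mul_assoc, ← Complex.exp_add, mul_comm]
  congr 2
  push_cast
  ring

lemma norm_mul_fourierCoeffOn_le {g : ℝ → ℂ} (hg : ContDiff ℝ 1 g) (hg1 : g 1 = g 0) (n : ℤ) :
    |(n : ℝ)| * ‖fourierCoeffOn zero_lt_one g n‖ ≤ ‖fourierCoeffOn zero_lt_one (deriv g) n‖ := by
  rcases eq_or_ne n 0 with rfl | hn
  · simp
  have h := fourierCoeffOn_of_hasDerivAt zero_lt_one hn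
    (fun x _ => (hg.differentiable one_ne_zero x).hasDerivAt)
    ((hg.continuous_deriv le_rfl).intervalIntegrable 0 1)
  have hn' : 0 < |(n : ℝ)| := by positivity
  rw [hg1, sub_self, mul_zero, zero_sub] at h
  rw [h]
  simp only [norm_mul, norm_div, norm_neg, norm_one, Complex.norm_I, Complex.norm_intCast,
    Complex.norm_real, Real.norm_eq_abs, abs_of_pos Real.pi_pos, Complex.norm_ofNat,
    Complex.ofReal_one, Complex.ofReal_zero, sub_zero, one_mul, mul_one]
  rw [← mul_assoc]
  refine mul_le_of_le_one_left (norm_nonneg _) ?_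
  rw [mul_one_div, div_le_one (by positivity)]
  nlinarith [Real.pi_gt_three]

/-- **`H^{1/2}`-type Sobolev embedding.** There is an absolute constant `C` such that for
every continuously differentiable `1`-periodic `m : ℝ → ℂ` and every `k ∈ ℤ`:
`∑_n |m^∨(n)| ≤ C (|m^∨(k)| + (‖m‖_{L²} ‖∂(e(k·)m)‖_{L²})^{1/2})` (in `[0,∞]`). -/
theorem sobolev_half_embedding :
    ∃ C : ℝ, 0 < C ∧ ∀ m : ℝ → ℂ, Function.Periodic m 1 → ContDiff ℝ 1 m → ∀ k : ℤ,
    ∑' n : ℤ, ENNReal.ofReal ‖invFourierCoeff m n‖ ≤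
      ENNReal.ofReal (C * (‖invFourierCoeff m k‖ +
        Real.sqrt (circleL2Norm m *
          circleL2Norm (deriv (fun β => expCirc ((k : ℝ) * β) * m β))))) := by
  refine ⟨4, by norm_num, fun m hper hm k => ?_⟩
  set g : ℝ → ℂ := fun β => expCirc ((k : ℝ) * β) * m β with hg_def
  have hg : ContDiff ℝ 1 g := (contDiff_expCirc_mul k).mul hm
  have hg1 : g 1 = g 0 := by
    have h1 : expCirc ((k : ℝ) * 1) = 1 := by
      rw [expCirc, Complex.exp_eq_one_iff]
      exact ⟨k, by push_cast; ring⟩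
    have h2 : m 1 = m 0 := by simpa using hper 0
    have h3 : expCirc ((k : ℝ) * 0) = 1 := by simp [expCirc]
    simp only [hg_def, h1, h2, h3]
  have hnorm : circleL2Norm g = circleL2Norm m := by
    simp only [circleL2Norm, hg_def, norm_mul, norm_expCirc, one_mul]
  have hcoeff (n : ℤ) : fourierCoeffOn zero_lt_one g n = invFourierCoeff m (k - n) :=
    fourierCoeffOn_expCirc_mul m k n
  have hmain := tsum_ofReal_int_le (c := fun n => ‖fourierCoeffOn zero_lt_one g n‖)
    (fun n => norm_nonneg _) (Real.sqrt_nonneg _) (Real.sqrt_nonneg _)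
    (fun s => sum_sq_fourierCoeffOn_le hg.continuous s)
    (fun s => (Finset.sum_le_sum fun n _ => by
      rw [← sq_abs, abs_mul, abs_norm]
      gcongr
      exact norm_mul_fourierCoeffOn_le hg hg1 n).trans
        (sum_sq_fourierCoeffOn_le (hg.continuous_deriv le_rfl) s))
  simp only [hcoeff, sub_zero] at hmain
  rw [← (Equiv.subLeft k).tsum_eq fun n => ENNReal.ofReal ‖invFourierCoeff m n‖]
  refine hmain.trans (ENNReal.ofReal_le_ofReal ?_)
  change _ + 4 * √(circleL2Norm g * circleL2Norm (deriv g)) ≤ _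
  rw [hnorm]
  linarith [norm_nonneg (invFourierCoeff m k)]
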